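/- arXiv:2202.07482 — 7 statements merged into one kernel-verified Lean document; each statement's English description precedes it below -/
import Mathlib

section
/- For every integer N ≥ 2, the equation R² − 1/2 + 1/(2N) + R^{2N}/(1 − R^{2N}) = 0 has exactly one solution R in the open interval (0,1). -/
/-- The left-hand side of the ring equation is strictly increasing on `[0, 1)`. -/
theorem ring_function_strictMonoOn (c : ℝ) (N : ℕ) (hN : N ≠ 0) :
    StrictMonoOn (fun R : ℝ => R ^ 2 - 1 / 2 + c + R ^ (2 * N) / (1 - R ^ (2 * N)))
      (Set.Ico 0 1) := by
  rintro x ⟨hx0, -⟩ y ⟨hy0, hy1⟩ hxy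
  have hsq : x ^ 2 < y ^ 2 := pow_lt_pow_left₀ hxy hx0 two_ne_zero
  have hpow : x ^ (2 * N) ≤ y ^ (2 * N) := pow_le_pow_left₀ hx0 hxy.le _
  have hlt : y ^ (2 * N) < 1 := pow_lt_one₀ hy0 hy1 (by omega)
  have hdiv : x ^ (2 * N) / (1 - x ^ (2 * N)) ≤ y ^ (2 * N) / (1 - y ^ (2 * N)) :=
    div_le_div₀ (by positivity) hpow (by linarith) (by linarith)
  dsimp only
  linarith

/-- For every integer `N ≥ 2`, the equation
`R² − 1/2 + 1/(2N) + R^{2N}/(1 − R^{2N}) = 0`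
has exactly one solution `R` in the open interval `(0,1)`. -/
theorem ring_radius_exists_unique (N : ℕ) (hN : 2 ≤ N) :
    ∃! R : ℝ, R ∈ Set.Ioo (0 : ℝ) 1 ∧
      R ^ 2 - 1 / 2 + 1 / (2 * (N : ℝ)) + R ^ (2 * N) / (1 - R ^ (2 * N)) = 0 := by
  have hN0 : N ≠ 0 := by omega
  have hNR : (2 : ℝ) ≤ N := by exact_mod_cast hN
  have hmono := ring_function_strictMonoOn (1 / (2 * (N : ℝ))) N hN0
  set f : ℝ → ℝ := fun R =>
    R ^ 2 - 1 / 2 + 1 / (2 * (N : ℝ)) + R ^ (2 * N) / (1 - R ^ (2 * N)) with hf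
  have hs0 : 0 ≤ √(1 / 2 : ℝ) := Real.sqrt_nonneg _
  have hs1 : √(1 / 2 : ℝ) < 1 := by
    rw [Real.sqrt_lt' one_pos]; norm_num
  have hlt : ∀ R : ℝ, 0 ≤ R → R < 1 → R ^ (2 * N) < 1 := fun R h0 h1 =>
    pow_lt_one₀ h0 h1 (by omega)
  have hcont : ContinuousOn f (Set.Icc 0 √(1 / 2 : ℝ)) := by
    refine ContinuousOn.add (by fun_prop) (ContinuousOn.div (by fun_prop) (by fun_prop) ?_)
    rintro R ⟨h0, h1⟩
    exact (sub_pos.2 (hlt R h0 (h1.trans_lt hs1))).ne'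
  have hneg : f 0 < 0 := by
    have hinv : 1 / (2 * (N : ℝ)) < 1 / 2 :=
      one_div_lt_one_div_of_lt (by norm_num) (by linarith)
    have hz : (0 : ℝ) ^ (2 * N) = 0 := zero_pow (by omega)
    simp only [hf, hz]
    linarith
  have hpos : 0 < f √(1 / 2 : ℝ) := by
    have hsq : √(1 / 2 : ℝ) ^ 2 = 1 / 2 := Real.sq_sqrt (by norm_num)
    have hinv : 0 < 1 / (2 * (N : ℝ)) := by positivity
    have hdiv : 0 ≤ √(1 / 2 : ℝ) ^ (2 * N) / (1 - √(1 / 2 : ℝ) ^ (2 * N)) :=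
      div_nonneg (pow_nonneg hs0 _) (sub_pos.2 (hlt _ hs0 hs1)).le
    simp only [hf, hsq]
    linarith
  obtain ⟨R, ⟨hR0, hR1⟩, hR⟩ := intermediate_value_Ioo hs0 hcont ⟨hneg, hpos⟩
  refine ⟨R, ⟨⟨hR0, hR1.trans hs1⟩, hR⟩, ?_⟩
  rintro S ⟨⟨hS0, hS1⟩, hS⟩
  exact hmono.injOn ⟨hS0.le, hS1⟩ ⟨hR0.le, hR1.trans hs1⟩ (Eq.trans hS hR.symm)
end

section
/- Let N ≥ 2 be an integer, m an integer with 0 < m < N, and a a real number with 0 < a < 1. Then the absolutely convergent double series Σ_{l=1}^{N−1} Σ_{n=1}^{∞} cos(2πnl/N) · exp(2πiml/N) · aⁿ equals N/(1 − a^N) · (a^m + a^{N−m})/2 − a/(1 − a). -/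
open Complex

/-- Orthogonality of the powers of a primitive root of unity. -/
lemma IsPrimitiveRoot.sum_pow_pow {K : Type*} [Field K] {ζ : K} {N : ℕ}
    (hζ : IsPrimitiveRoot ζ N) (j : ℕ) :
    ∑ l ∈ Finset.range N, (ζ ^ l) ^ j = if N ∣ j then (N : K) else 0 := by
  have hcomm : ∀ l, (ζ ^ l) ^ j = (ζ ^ j) ^ l := fun l => by rw [← pow_mul, ← pow_mul, mul_comm]
  simp only [hcomm]
  split_ifs with h
  · simp [(hζ.pow_eq_one_iff_dvd j).2 h]
  · have hne : ζ ^ j ≠ 1 := fun h1 => h ((hζ.pow_eq_one_iff_dvd j).1 h1)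
    rw [geom_sum_eq hne, ← pow_mul, mul_comm, pow_mul, hζ.pow_eq_one]
    simp

/-- A geometric series twisted by an `N`-th root of unity, as a sum over one period. -/
lemma hasSum_mul_pow_succ_of_pow_eq_one {w a : ℂ} {N : ℕ} (hN : N ≠ 0) (hw : w ^ N = 1)
    (ha : ‖a‖ < 1) :
    HasSum (fun n : ℕ => (w * a) ^ (n + 1))
      ((∑ r ∈ Finset.range N, (w * a) ^ (r + 1)) / (1 - a ^ N)) := by
  have hnorm : ‖w * a‖ < 1 := by
    rw [norm_mul, norm_eq_one_of_pow_eq_one hw hN, one_mul]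
    exact ha
  have hne : w * a ≠ 1 := by
    rintro h
    simp [h] at hnorm
  have haN : 1 - a ^ N ≠ 0 := by
    intro h
    have h1 : ‖a ^ N‖ < 1 := by
      rw [norm_pow]
      exact pow_lt_one₀ (norm_nonneg a) ha hN
    rw [← sub_eq_zero.1 h] at h1
    simp at h1
  have h1 := (hasSum_geometric_of_norm_lt_one hnorm).mul_right (w * a)
  simp only [← pow_succ] at h1
  have hg := mul_neg_geom_sum (w * a) N
  rw [mul_pow w a N, hw, one_mul] at hg
  have hs : 1 - w * a ≠ 0 := sub_ne_zero.2 hne.symm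
  suffices h : (∑ r ∈ Finset.range N, (w * a) ^ (r + 1)) / (1 - a ^ N) =
      (1 - w * a)⁻¹ * (w * a) by
    rw [h]
    exact h1
  rw [Finset.sum_congr rfl fun r _ => pow_succ (w * a) r, ← Finset.sum_mul, div_eq_iff haN, ← hg]
  field_simp

/-- Averaging twisted geometric series over the `N`-th roots of unity selects one residue class
of exponents. -/
lemma IsPrimitiveRoot.sum_tsum_mul_pow_succ {ζ a : ℂ} {N k : ℕ} (hζ : IsPrimitiveRoot ζ N)
    (hk : 0 < k) (hkN : k ≤ N) (ha : ‖a‖ < 1) :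
    ∑ l ∈ Finset.range N, (∑' n : ℕ, (ζ ^ l * a) ^ (n + 1)) * (ζ ^ l) ^ (N - k) =
      N * a ^ k / (1 - a ^ N) := by
  have hN : N ≠ 0 := by omega
  have hw : ∀ l, (ζ ^ l) ^ N = 1 := fun l => by
    rw [← pow_mul, mul_comm, pow_mul, hζ.pow_eq_one, one_pow]
  have hl : ∀ l, (∑' n : ℕ, (ζ ^ l * a) ^ (n + 1)) * (ζ ^ l) ^ (N - k) =
      (∑ r ∈ Finset.range N, a ^ (r + 1) * (ζ ^ l) ^ (r + 1 + (N - k))) / (1 - a ^ N) := by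
    intro l
    rw [(hasSum_mul_pow_succ_of_pow_eq_one hN (hw l) ha).tsum_eq, div_mul_eq_mul_div,
      Finset.sum_mul]
    congr 1
    refine Finset.sum_congr rfl fun r _ => ?_
    rw [mul_pow, pow_add _ (r + 1)]
    ring
  simp only [hl]
  rw [← Finset.sum_div, Finset.sum_comm]
  simp only [← Finset.mul_sum, hζ.sum_pow_pow]
  congr 1
  rw [Finset.sum_eq_single (k - 1)]
  · rw [if_pos (by rw [show k - 1 + 1 + (N - k) = N by omega]), Nat.sub_add_cancel hk, mul_comm]
  · intro r hr hrk
    rw [Finset.mem_range] at hr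
    rw [if_neg, mul_zero]
    rintro ⟨c, hc⟩
    have h1 : N * c < N * 2 := by omega
    have h2 : N * 0 < N * c := by omega
    have h3 := Nat.lt_of_mul_lt_mul_left h1
    have h4 := Nat.lt_of_mul_lt_mul_left h2
    obtain rfl : c = 1 := by omega
    omega
  · intro h
    exact absurd (Finset.mem_range.2 (by omega)) h

/-- For `N ≥ 2`, `0 < m < N` and `0 < a < 1`, the absolutely convergent double series
`Σ_{l=1}^{N−1} Σ_{n=1}^{∞} cos(2πnl/N) · exp(2πiml/N) · aⁿ` equals
`N/(1 − a^N) · (a^m + a^{N−m})/2 − a/(1 − a)`. -/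
theorem a_rho_prime_closed_form (N m : ℕ) (hN : 2 ≤ N) (hm : 0 < m) (hmN : m < N)
    (a : ℝ) (ha0 : 0 < a) (ha1 : a < 1) :
    ∑ l ∈ Finset.Ico 1 N, ∑' n : ℕ,
        (Real.cos (2 * Real.pi * (n + 1) * l / N) : ℂ) *
          Complex.exp (2 * Real.pi * Complex.I * m * l / N) * (a : ℂ) ^ (n + 1)
      = (((N : ℝ) / (1 - a ^ N) * ((a ^ m + a ^ (N - m)) / 2) - a / (1 - a) : ℝ) : ℂ) := by
  have hN0 : N ≠ 0 := by omega
  have ha : ‖(a : ℂ)‖ < 1 := by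
    rw [Complex.norm_real, Real.norm_of_nonneg ha0.le]
    exact ha1
  obtain ⟨ζ, hζe⟩ : ∃ ζ, ζ = Complex.exp (2 * Real.pi * Complex.I / N) := ⟨_, rfl⟩
  have hζ : IsPrimitiveRoot ζ N := hζe ▸ Complex.isPrimitiveRoot_exp N hN0
  have hw : ∀ (ξ : ℂ), IsPrimitiveRoot ξ N → ∀ l, (ξ ^ l) ^ N = 1 := fun ξ hξ l => by
    rw [← pow_mul, mul_comm, pow_mul, hξ.pow_eq_one, one_pow]
  have hexp : ∀ l : ℕ, Complex.exp (2 * Real.pi * Complex.I * m * l / N) = (ζ ^ l) ^ m := by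
    intro l
    rw [hζe, ← Complex.exp_nat_mul, ← Complex.exp_nat_mul]
    congr 1
    ring
  have hcos : ∀ n l : ℕ, (Real.cos (2 * Real.pi * (n + 1) * l / N) : ℂ) =
      ((ζ ^ l) ^ (n + 1) + (ζ⁻¹ ^ l) ^ (n + 1)) / 2 := by
    intro n l
    rw [Complex.ofReal_cos, Complex.cos, hζe, ← Complex.exp_neg]
    simp only [← Complex.exp_nat_mul]
    push_cast
    congr 3 <;> ring
  have hinv : ∀ l : ℕ, (ζ ^ l) ^ m = (ζ⁻¹ ^ l) ^ (N - m) := by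
    intro l
    have h1 := hw ζ hζ l
    rw [inv_pow, inv_pow]
    refine eq_inv_of_mul_eq_one_left ?_
    rw [← pow_add, Nat.add_sub_cancel' hmN.le, h1]
  have hterm : ∀ l : ℕ, ∑' n : ℕ, (Real.cos (2 * Real.pi * (n + 1) * l / N) : ℂ) *
      Complex.exp (2 * Real.pi * Complex.I * m * l / N) * (a : ℂ) ^ (n + 1) =
      ((∑' n : ℕ, (ζ ^ l * a) ^ (n + 1)) * (ζ ^ l) ^ (N - (N - m)) +
        (∑' n : ℕ, (ζ⁻¹ ^ l * a) ^ (n + 1)) * (ζ⁻¹ ^ l) ^ (N - m)) / 2 := by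
    intro l
    have h1 := (hasSum_mul_pow_succ_of_pow_eq_one hN0 (hw ζ hζ l) ha).summable.hasSum
    have h2 := (hasSum_mul_pow_succ_of_pow_eq_one hN0 (hw _ hζ.inv l) ha).summable.hasSum
    rw [← hinv, Nat.sub_sub_self hmN.le, ← add_mul, mul_div_right_comm _ ((ζ ^ l) ^ m),
      ← (((h1.add h2).div_const 2).mul_right ((ζ ^ l) ^ m)).tsum_eq]
    refine tsum_congr fun n => ?_
    rw [hcos, hexp, mul_pow, mul_pow]
    ring
  have hzero : ∑' n : ℕ, (Real.cos (2 * Real.pi * (n + 1) * (0 : ℕ) / N) : ℂ) *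
      Complex.exp (2 * Real.pi * Complex.I * m * (0 : ℕ) / N) * (a : ℂ) ^ (n + 1) =
      a / (1 - a) := by
    have h := (hasSum_geometric_of_norm_lt_one ha).mul_right (a : ℂ)
    simp only [← pow_succ] at h
    simpa [div_eq_mul_inv, mul_comm] using h.tsum_eq
  have hfull := Finset.sum_congr (rfl : Finset.range N = Finset.range N) fun l _ => hterm l
  rw [← Finset.sum_div, Finset.sum_add_distrib,
    hζ.sum_tsum_mul_pow_succ (Nat.sub_pos_of_lt hmN) (Nat.sub_le N m) ha,
    hζ.inv.sum_tsum_mul_pow_succ hm hmN.le ha,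
    Finset.range_eq_Ico, Finset.sum_eq_sum_Ico_succ_bot (by omega), hzero] at hfull
  rw [eq_sub_of_add_eq' hfull]
  push_cast
  ring
end

section
/- Let N ≥ 2 be an integer and a a real number with 0 < a < 1. Then Σ_{l=1}^{N−1} Σ_{n=1}^{∞} cos(2πnl/N) · aⁿ equals N/(1 − a^N) − N − a/(1 − a). -/
theorem sum_range_cos_two_pi_mul_div {N : ℕ} (hN : N ≠ 0) (m : ℕ) :
    ∑ l ∈ Finset.range N, Real.cos (2 * Real.pi * m * l / N) = if N ∣ m then (N : ℝ) else 0 := by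
  have hζ := Complex.isPrimitiveRoot_exp N hN
  set ζ := Complex.exp (2 * Real.pi * Complex.I / N) with hζ_def
  have hcos (l : ℕ) : Real.cos (2 * Real.pi * m * l / N) = ((ζ ^ m) ^ l).re := by
    rw [hζ_def, ← pow_mul, ← Complex.exp_nat_mul, ← Complex.exp_ofReal_mul_I_re]
    congr 2
    push_cast
    ring
  simp_rw [hcos, ← Complex.re_sum]
  split_ifs with h
  · simp [(hζ.pow_eq_one_iff_dvd m).2 h]
  · have hne : ζ ^ m - 1 ≠ 0 := sub_ne_zero.2 fun h1 ↦ h ((hζ.pow_eq_one_iff_dvd m).1 h1)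
    have hmul := geom_sum_mul (ζ ^ m) N
    rw [pow_right_comm, hζ.pow_eq_one, one_pow, sub_self] at hmul
    simp [(mul_eq_zero.1 hmul).resolve_right hne]

theorem hasSum_ite_dvd_geometric {N : ℕ} (hN : N ≠ 0) {a : ℝ} (ha0 : 0 ≤ a) (ha1 : a < 1) :
    HasSum (fun n : ℕ ↦ if N ∣ n then a ^ n else 0) (1 - a ^ N)⁻¹ := by
  have hinj : Function.Injective fun k : ℕ ↦ N * k := mul_right_injective₀ hN
  refine (hinj.hasSum_iff fun n hn ↦ if_neg fun ⟨k, hk⟩ ↦ hn ⟨k, hk.symm⟩).1 ?_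
  simpa [Function.comp_def, pow_mul] using
    hasSum_geometric_of_lt_one (pow_nonneg ha0 N) (pow_lt_one₀ ha0 ha1 hN)

/-- For `N ≥ 2` and `0 < a < 1`,
`Σ_{l=1}^{N−1} Σ_{n=1}^{∞} cos(2πnl/N) · aⁿ = N/(1 − a^N) − N − a/(1 − a)`. -/
theorem a_rho_prime_closed_form_m_zero (N : ℕ) (hN : 2 ≤ N)
    (a : ℝ) (ha0 : 0 < a) (ha1 : a < 1) :
    ∑ l ∈ Finset.Ico 1 N, ∑' n : ℕ,
        Real.cos (2 * Real.pi * (n + 1) * l / N) * a ^ (n + 1)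
      = (N : ℝ) / (1 - a ^ N) - N - a / (1 - a) := by
  have hN0 : N ≠ 0 := by omega
  have hgeom := hasSum_geometric_of_lt_one ha0.le ha1
  have hsummable (l : ℕ) :
      Summable fun n : ℕ ↦ Real.cos (2 * Real.pi * (n + 1) * l / N) * a ^ (n + 1) := by
    refine .of_norm_bounded ((summable_nat_add_iff 1).2 hgeom.summable) fun n ↦ ?_
    rw [norm_mul, Real.norm_of_nonneg (pow_nonneg ha0.le _)]
    exact mul_le_of_le_one_left (pow_nonneg ha0.le _) (Real.abs_cos_le_one _)
  rw [← Summable.tsum_finsetSum fun l _ ↦ hsummable l]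
  have hterm (n : ℕ) :
      ∑ l ∈ Finset.Ico 1 N, Real.cos (2 * Real.pi * (n + 1) * l / N) * a ^ (n + 1)
        = N * (if N ∣ n + 1 then a ^ (n + 1) else 0) - a ^ (n + 1) := by
    have hsum := sum_range_cos_two_pi_mul_div hN0 (n + 1)
    rw [Finset.range_eq_Ico, Finset.sum_eq_sum_Ico_succ_bot (by omega)] at hsum
    push_cast at hsum
    rw [← Finset.sum_mul, ← sub_eq_of_eq_add' hsum.symm]
    split_ifs <;> simp [sub_mul]
  simp_rw [hterm]
  have hdvd := (hasSum_nat_add_iff' 1).2 (hasSum_ite_dvd_geometric hN0 ha0.le ha1)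
  have hshift := (hasSum_nat_add_iff' 1).2 hgeom
  rw [((hdvd.mul_left (N : ℝ)).sub hshift).tsum_eq]
  have h1 : 1 - a ≠ 0 := by linarith
  simp only [Finset.sum_range_one, dvd_zero, if_true, pow_zero]
  field_simp
  ring
end

section
/- Let N ≥ 2 be an integer and m an integer with 0 < m < N. Then the function f(a) = N·(a^m + a^{N−m})/(2(1 − a^N)) − a/(1 − a) tends to 1/2 as a → 1 from the left. -/
open Filter Topology

lemma hasDerivAt_pow_add_pow_sub_geom_sum_at_one {N m : ℕ} (hmN : m ≤ N) :
    HasDerivAt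
      (fun a : ℝ => (N : ℝ) * (a ^ m + a ^ (N - m)) - 2 * ∑ i ∈ Finset.range N, a ^ (i + 1))
      (-N) 1 := by
  have hsum : HasDerivAt (fun a : ℝ => ∑ i ∈ Finset.range N, a ^ (i + 1))
      (∑ i ∈ Finset.range N, ((i + 1 : ℕ) : ℝ) * 1 ^ i) 1 :=
    HasDerivAt.fun_sum fun i _ => by simpa using hasDerivAt_pow (i + 1) (1 : ℝ)
  have hgauss : ∀ n : ℕ, 2 * ∑ i ∈ Finset.range n, ((i : ℝ) + 1) = n * (n + 1) := by
    intro n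
    induction n with
    | zero => simp
    | succ k ih => rw [Finset.sum_range_succ, mul_add, ih]; push_cast; ring
  refine ((((hasDerivAt_pow m (1 : ℝ)).add (hasDerivAt_pow (N - m) 1)).const_mul (N : ℝ)).sub
    (hsum.const_mul 2)).congr_deriv ?_
  simp only [one_pow, mul_one, Nat.cast_sub hmN, Nat.cast_add, Nat.cast_one, hgauss]
  ring

/-- For `N ≥ 2` and `0 < m < N`, the function
`f(a) = N·(a^m + a^{N−m})/(2(1 − a^N)) − a/(1 − a)` tends to `1/2` as `a → 1⁻`. -/
theorem limit_a_rho_prime (N m : ℕ) (hN : 2 ≤ N) (hm : 0 < m) (hmN : m < N) :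
    Tendsto (fun a : ℝ => (N : ℝ) * (a ^ m + a ^ (N - m)) / (2 * (1 - a ^ N)) - a / (1 - a))
      (𝓝[<] (1 : ℝ)) (𝓝 (1 / 2)) := by
  have hN0 : (N : ℝ) ≠ 0 := by positivity
  have hslope := (hasDerivAt_iff_tendsto_slope.1
    (hasDerivAt_pow_add_pow_sub_geom_sum_at_one hmN.le)).mono_left
      (nhdsWithin_mono 1 fun a (ha : a < 1) => ha.ne)
  have hgeom : Tendsto (fun a : ℝ => -2 * ∑ i ∈ Finset.range N, a ^ i) (𝓝[<] 1) (𝓝 (-2 * N)) := by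
    have hcont : Continuous fun a : ℝ => -2 * ∑ i ∈ Finset.range N, a ^ i := by fun_prop
    simpa using (hcont.tendsto 1).mono_left nhdsWithin_le_nhds
  have hlim := hslope.div hgeom (by simpa using hN0)
  rw [show -(N : ℝ) / (-2 * N) = 1 / 2 by field_simp] at hlim
  refine hlim.congr' ?_
  filter_upwards [Ioo_mem_nhdsLT (zero_lt_one (α := ℝ))] with a ⟨ha0, ha1⟩
  have h1a : 1 - a ≠ 0 := (sub_pos.2 ha1).ne'
  have hS : ∑ i ∈ Finset.range N, a ^ i ≠ 0 :=
    (Finset.sum_pos (fun i _ => pow_pos ha0 i) ⟨0, Finset.mem_range.2 (by lia)⟩).ne'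
  simp only [Pi.div_apply, slope_def_field, one_pow, Finset.sum_const, Finset.card_range,
    nsmul_eq_mul, mul_one, pow_succ, ← Finset.sum_mul]
  rw [← mul_neg_geom_sum a N]
  generalize ∑ i ∈ Finset.range N, a ^ i = S at hS ⊢
  rw [show a - 1 = -(1 - a) by ring]
  field_simp
  ring
end

section
/- Let N ≥ 2 be an integer and m an integer with 0 < m < N. Then the derivative f'(a) of the function f(a) = N·(a^m + a^{N−m})/(2(1 − a^N)) − a/(1 − a) tends to (1 − N²)/12 + m(N − m)/2 as a → 1 from the left. -/
open Filter Topology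

open Polynomial in
theorem eval_one_geom_sum (k : ℕ) : (∑ i ∈ Finset.range k, (X : ℝ[X]) ^ i).eval 1 = k := by
  simp [eval_finsetSum]

open Polynomial in
theorem eval_one_derivative_geom_sum (k : ℕ) :
    (derivative (∑ i ∈ Finset.range k, (X : ℝ[X]) ^ i)).eval 1 = k * (k - 1) / 2 := by
  induction k with
  | zero => simp
  | succ k ih =>
    rw [Finset.sum_range_succ, derivative_add, eval_add, ih]
    simp only [derivative_X_pow, eval_mul, eval_C, eval_pow, eval_X, one_pow]
    push_cast
    ring

/-- If `f` agrees with a quotient of polynomials to the left of `x`, and the denominator does not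
vanish at `x`, then the derivative of `f` tends to that of the quotient at `x`. -/
theorem tendsto_deriv_of_eq_eval_div (p q : Polynomial ℝ) (f : ℝ → ℝ) (x : ℝ)
    (hq : q.eval x ≠ 0) (hf : f =ᶠ[𝓝[<] x] fun a => p.eval a / q.eval a) :
    Tendsto (deriv f) (𝓝[<] x)
      (𝓝 ((p.derivative.eval x * q.eval x - p.eval x * q.derivative.eval x) / q.eval x ^ 2)) := by
  have hlim : Tendsto
      (fun a => (p.derivative.eval a * q.eval a - p.eval a * q.derivative.eval a) / q.eval a ^ 2)
      (𝓝[<] x)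
      (𝓝 ((p.derivative.eval x * q.eval x - p.eval x * q.derivative.eval x) / q.eval x ^ 2)) := by
    refine Tendsto.mono_left (ContinuousAt.tendsto ?_) nhdsWithin_le_nhds
    exact ((p.derivative.continuous.mul q.continuous).sub
      (p.continuous.mul q.derivative.continuous)).continuousAt.div
      (q.continuous.pow 2).continuousAt (pow_ne_zero 2 hq)
  refine hlim.congr' ?_
  have hne : ∀ᶠ a in 𝓝[<] x, q.eval a ≠ 0 :=
    (q.continuous.continuousAt.eventually_ne hq).filter_mono nhdsWithin_le_nhds
  filter_upwards [hne, eventually_eventually_nhdsWithin.mpr hf, self_mem_nhdsWithin]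
    with a ha hfa hax
  rw [isOpen_Iio.nhdsWithin_eq hax] at hfa
  exact (((p.hasDerivAt a).div (q.hasDerivAt a) ha).congr_of_eventuallyEq hfa).deriv.symm

theorem sum_range_succ_mul_self_div_two (N : ℕ) :
    ∑ i ∈ Finset.range N, (((i + 1 : ℕ) : ℝ) * (((i + 1 : ℕ) : ℝ) - 1) / 2)
      = ((N : ℝ) - 1) * N * (N + 1) / 6 := by
  induction N with
  | zero => simp
  | succ k ih =>
    rw [Finset.sum_range_succ, ih]
    push_cast
    ring

theorem sum_range_cast_succ (N : ℕ) :
    ∑ i ∈ Finset.range N, ((i + 1 : ℕ) : ℝ) = (N : ℝ) * (N + 1) / 2 := by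
  induction N with
  | zero => simp
  | succ k ih =>
    rw [Finset.sum_range_succ, ih]
    push_cast
    ring

theorem sub_mul_geom_sum_eq (N : ℕ) (a : ℝ) :
    (1 - a) * ∑ i ∈ Finset.range N, ∑ j ∈ Finset.range (i + 1), a ^ j
      = N - a * ∑ i ∈ Finset.range N, a ^ i := by
  simp_rw [Finset.mul_sum (Finset.range N), mul_neg_geom_sum, Finset.sum_sub_distrib, pow_succ']
  simp

/-- For `N ≥ 2` and `0 < m < N`, the derivative of
`f(a) = N·(a^m + a^{N−m})/(2(1 − a^N)) − a/(1 − a)` tends to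
`(1 − N²)/12 + m(N − m)/2` as `a → 1⁻`. -/
theorem limit_deriv_a_rho_prime (N m : ℕ) (hN : 2 ≤ N) (hm : 0 < m) (hmN : m < N) :
    Tendsto
      (deriv fun a : ℝ =>
        (N : ℝ) * (a ^ m + a ^ (N - m)) / (2 * (1 - a ^ N)) - a / (1 - a))
      (𝓝[<] (1 : ℝ))
      (𝓝 ((1 - (N : ℝ) ^ 2) / 12 + (m : ℝ) * ((N : ℝ) - (m : ℝ)) / 2)) := by
  have hN0 : (N : ℝ) ≠ 0 := by positivity
  let S : ℕ → Polynomial ℝ := fun k => ∑ i ∈ Finset.range k, Polynomial.X ^ i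
  have hS (k : ℕ) (a : ℝ) : (S k).eval a = ∑ i ∈ Finset.range k, a ^ i := by
    simp [S, Polynomial.eval_finsetSum]
  have hS1 (k : ℕ) : (S k).eval 1 = k := eval_one_geom_sum k
  have hS1' (k : ℕ) : (S k).derivative.eval 1 = k * (k - 1) / 2 := eval_one_derivative_geom_sum k
  let p : Polynomial ℝ := Polynomial.C 2 * ∑ i ∈ Finset.range N, S (i + 1)
    - Polynomial.C (N : ℝ) * (S m + S (N - m))
  let q : Polynomial ℝ := Polynomial.C 2 * S N
  have hp1 : p.eval 1 = N := by
    simp only [p, Polynomial.eval_sub, Polynomial.eval_mul, Polynomial.eval_C, Polynomial.eval_add,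
      Polynomial.eval_finsetSum, hS1, sum_range_cast_succ, Nat.cast_sub hmN.le]
    ring
  have hp1' : p.derivative.eval 1 = ((N : ℝ) - 1) * N * (N + 1) / 3
      - N * (m * (m - 1) + (N - m) * (N - m - 1)) / 2 := by
    simp only [p, Polynomial.derivative_sub, Polynomial.derivative_C_mul, Polynomial.derivative_add,
      Polynomial.derivative_sum, Polynomial.eval_sub, Polynomial.eval_mul, Polynomial.eval_C,
      Polynomial.eval_add, Polynomial.eval_finsetSum, hS1', sum_range_succ_mul_self_div_two,
      Nat.cast_sub hmN.le]
    ring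
  have hq1 : q.eval 1 = 2 * N := by simp [q, hS1]
  have hq1' : q.derivative.eval 1 = N * (N - 1) := by
    simp only [q, Polynomial.derivative_C_mul, Polynomial.eval_mul, Polynomial.eval_C, hS1']
    ring
  have hq : q.eval 1 ≠ 0 := by rw [hq1]; positivity
  convert tendsto_deriv_of_eq_eval_div p q _ 1 hq ?_ using 2
  · rw [hp1, hp1', hq1, hq1']
    field_simp
    ring
  · have hne : ∀ᶠ a in 𝓝[<] (1 : ℝ), q.eval a ≠ 0 :=
      (q.continuous.continuousAt.eventually_ne hq).filter_mono nhdsWithin_le_nhds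
    filter_upwards [hne, self_mem_nhdsWithin] with a ha (ha1 : a < 1)
    have h1a : 1 - a ≠ 0 := sub_ne_zero.mpr ha1.ne'
    have hqa : q.eval a = 2 * ∑ i ∈ Finset.range N, a ^ i := by simp [q, hS]
    have hsum : ∑ i ∈ Finset.range N, a ^ i ≠ 0 := fun h => ha (by rw [hqa, h, mul_zero])
    have hpa : (1 - a) * p.eval a
        = N * (a ^ m + a ^ (N - m)) - 2 * a * ∑ i ∈ Finset.range N, a ^ i := by
      simp only [p, Polynomial.eval_sub, Polynomial.eval_mul, Polynomial.eval_C,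
        Polynomial.eval_add, Polynomial.eval_finsetSum, hS]
      linear_combination 2 * sub_mul_geom_sum_eq N a - N * mul_neg_geom_sum a m
        - N * mul_neg_geom_sum a (N - m)
    rw [hqa, ← mul_neg_geom_sum a N, eq_div_iff (mul_ne_zero two_ne_zero hsum)]
    field_simp
    linear_combination -hpa
end

section
/- Let n ≥ 1 be an integer and b, R real numbers with 0 < b < R < 1. Define g(r) = (Rⁿ + R^{−n})(rⁿ + r^{−n} b^{2n}) / (2πn(1 − b^{2n})) for b ≤ r < R and g(r) = (rⁿ + r^{−n})(Rⁿ + R^{−n} b^{2n}) / (2πn(1 − b^{2n})) for R < r ≤ 1. Then: (i) g''(r) + g'(r)/r − n² g(r)/r² = 0 for all r in (b,R) and in (R,1); (ii) g is continuous at r = R; (iii) g'(R⁺) − g'(R⁻) = −1/(πR); and (iv) g'(b) = 0 and g'(1) = 0. -/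
/-- The derivative of the radial mode `A rⁿ + B r⁻ⁿ`, away from the origin. -/
theorem hasDerivAt_radial_mode (n : ℕ) (A B : ℝ) {r : ℝ} (hr : r ≠ 0) :
    HasDerivAt (fun r : ℝ => A * r ^ n + B * r ^ (-(n : ℤ)))
      (n * (A * r ^ n - B * r ^ (-(n : ℤ))) / r) r := by
  have h₁ := (hasDerivAt_zpow (n : ℤ) r (Or.inl hr)).const_mul A
  have h₂ := (hasDerivAt_zpow (-(n : ℤ)) r (Or.inl hr)).const_mul B
  have h := h₁.add h₂
  simp only [zpow_sub_one₀ hr, zpow_natCast] at h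
  refine h.congr_deriv ?_
  push_cast
  ring

theorem deriv_radial_mode (n : ℕ) (A B : ℝ) {r : ℝ} (hr : r ≠ 0) :
    deriv (fun r : ℝ => A * r ^ n + B * r ^ (-(n : ℤ))) r =
      n * (A * r ^ n - B * r ^ (-(n : ℤ))) / r :=
  (hasDerivAt_radial_mode n A B hr).deriv

/-- The radial mode `A rⁿ + B r⁻ⁿ` solves `g'' + g'/r − n² g/r² = 0` away from the origin. -/
theorem radial_mode_ode (n : ℕ) (A B : ℝ) {r : ℝ} (hr : r ≠ 0) :
    deriv (deriv fun r : ℝ => A * r ^ n + B * r ^ (-(n : ℤ))) r +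
        deriv (fun r : ℝ => A * r ^ n + B * r ^ (-(n : ℤ))) r / r -
      n ^ 2 * (A * r ^ n + B * r ^ (-(n : ℤ))) / r ^ 2 = 0 := by
  have hev : (deriv fun r : ℝ => A * r ^ n + B * r ^ (-(n : ℤ))) =ᶠ[nhds r]
      fun r => n * (A * r ^ n + -B * r ^ (-(n : ℤ))) / r := by
    filter_upwards [isOpen_ne.mem_nhds hr] with x hx
    rw [deriv_radial_mode n A B hx]
    ring
  have h := ((hasDerivAt_radial_mode n A (-B) hr).const_mul (n : ℝ)).fun_div (hasDerivAt_id' r) hr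
  rw [hev.deriv_eq, h.deriv, deriv_radial_mode n A B hr]
  field_simp
  ring


/-- The `n`-th Fourier mode of the Neumann Green's function of the annulus
`b < |x| < 1`: with
`g₁(r) = (Rⁿ + R^{−n})(rⁿ + r^{−n} b^{2n}) / (2πn(1 − b^{2n}))` (for `b ≤ r < R`) and
`g₂(r) = (rⁿ + r^{−n})(Rⁿ + R^{−n} b^{2n}) / (2πn(1 − b^{2n}))` (for `R < r ≤ 1`),
one has (i) the radial modal ODE `g'' + g'/r − n²g/r² = 0` on `(b,R)` and `(R,1)`,
(ii) continuity at `r = R`, (iii) derivative jump `g'(R⁺) − g'(R⁻) = −1/(πR)`,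
and (iv) the Neumann conditions `g'(b) = 0` and `g'(1) = 0`. -/
theorem annulus_green_mode (n : ℕ) (hn : 1 ≤ n) (b R : ℝ)
    (hb0 : 0 < b) (hbR : b < R) (hR1 : R < 1)
    (g₁ g₂ : ℝ → ℝ)
    (hg₁ : g₁ = fun r : ℝ =>
      (R ^ n + R ^ (-(n : ℤ))) * (r ^ n + r ^ (-(n : ℤ)) * b ^ (2 * n)) /
        (2 * Real.pi * n * (1 - b ^ (2 * n))))
    (hg₂ : g₂ = fun r : ℝ =>
      (r ^ n + r ^ (-(n : ℤ))) * (R ^ n + R ^ (-(n : ℤ)) * b ^ (2 * n)) /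
        (2 * Real.pi * n * (1 - b ^ (2 * n)))) :
    (∀ r ∈ Set.Ioo b R,
        deriv (deriv g₁) r + deriv g₁ r / r - n ^ 2 * g₁ r / r ^ 2 = 0) ∧
    (∀ r ∈ Set.Ioo R (1 : ℝ),
        deriv (deriv g₂) r + deriv g₂ r / r - n ^ 2 * g₂ r / r ^ 2 = 0) ∧
    g₁ R = g₂ R ∧
    deriv g₂ R - deriv g₁ R = -(1 / (Real.pi * R)) ∧
    deriv g₁ b = 0 ∧
    deriv g₂ 1 = 0 := by
  have hR : R ≠ 0 := (hb0.trans hbR).ne'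
  have hn' : (n : ℝ) ≠ 0 := by positivity
  have hb : 1 - b ^ (2 * n) ≠ 0 :=
    (sub_pos.2 (pow_lt_one₀ hb0.le (hbR.trans hR1) (by omega))).ne'
  set D : ℝ := 2 * Real.pi * n * (1 - b ^ (2 * n)) with hD
  have h₁ : g₁ = fun r : ℝ => (R ^ n + R ^ (-(n : ℤ))) / D * r ^ n +
      (R ^ n + R ^ (-(n : ℤ))) * b ^ (2 * n) / D * r ^ (-(n : ℤ)) := by
    rw [hg₁]
    funext r
    ring
  have h₂ : g₂ = fun r : ℝ => (R ^ n + R ^ (-(n : ℤ)) * b ^ (2 * n)) / D * r ^ n +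
      (R ^ n + R ^ (-(n : ℤ)) * b ^ (2 * n)) / D * r ^ (-(n : ℤ)) := by
    rw [hg₂]
    funext r
    ring
  refine ⟨fun r hr => ?_, fun r hr => ?_, ?_, ?_, ?_, ?_⟩
  · rw [h₁]
    exact radial_mode_ode n _ _ (hb0.trans hr.1).ne'
  · rw [h₂]
    exact radial_mode_ode n _ _ ((hb0.trans hbR).trans hr.1).ne'
  · rw [hg₁, hg₂]
  · rw [h₁, h₂, deriv_radial_mode n _ _ hR, deriv_radial_mode n _ _ hR, hD, zpow_neg,
      zpow_natCast]
    field_simp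
    ring
  · rw [h₁, deriv_radial_mode n _ _ hb0.ne', zpow_neg b, zpow_natCast b]
    field_simp
    ring
  · rw [h₂, deriv_radial_mode n _ _ one_ne_zero]
    simp
end

section
/- Let r, R, θ be real numbers with 0 ≤ r < R < 1. Then (1/(2π))·[ r²/2 + R²/2 − ln R − 3/4 + Σ_{n=1}^{∞} cos(nθ)·(rⁿRⁿ + rⁿR^{−n})/n ] = −(1/(4π))·ln(r² + R² − 2rR cos θ) + (1/(4π))·[ −ln(r²R² + 1 − 2rR cos θ) + r² + R² − 3/2 ], where for θ with cos θ = 1 and r = 0 the logarithm terms are interpreted with r² + R² − 2rR cos θ = (R − r)² > 0. -/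
/-- Real part of the Taylor series of `-log (1 - ρ e^{iθ})`. -/
lemma hasSum_cos_mul_pow_div {ρ : ℝ} (h0 : 0 ≤ ρ) (h1 : ρ < 1) (θ : ℝ) :
    HasSum (fun n : ℕ => Real.cos ((n + 1) * θ) * ρ ^ (n + 1) / (n + 1))
      (-(Real.log (1 + ρ ^ 2 - 2 * ρ * Real.cos θ) / 2)) := by
  set z : ℂ := ρ * Complex.exp (θ * Complex.I) with hz
  have hnorm : ‖z‖ < 1 := by
    simpa [hz, Complex.norm_exp_ofReal_mul_I, abs_of_nonneg h0] using h1
  have hsq : ‖1 - z‖ ^ 2 = 1 + ρ ^ 2 - 2 * ρ * Real.cos θ := by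
    rw [← Complex.normSq_eq_norm_sq, Complex.normSq_apply]
    simp only [hz, Complex.sub_re, Complex.sub_im, Complex.one_re, Complex.one_im,
      Complex.re_ofReal_mul, Complex.im_ofReal_mul, Complex.exp_ofReal_mul_I_re,
      Complex.exp_ofReal_mul_I_im]
    linear_combination ρ ^ 2 * Real.sin_sq_add_cos_sq θ
  have hsum := Complex.hasSum_re (Complex.hasSum_taylorSeries_neg_log' hnorm)
  convert hsum using 1
  · ext n
    have hpow : z ^ (n + 1) =
        ((ρ ^ (n + 1) : ℝ) : ℂ) * Complex.exp (((n + 1) * θ : ℝ) * Complex.I) := by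
      rw [hz, mul_pow, ← Complex.exp_nat_mul]
      push_cast
      ring_nf
    have hcast : ((n : ℂ) + 1) = ((n + 1 : ℝ) : ℂ) := by push_cast; rfl
    rw [hpow, hcast, Complex.div_ofReal_re, Complex.re_ofReal_mul, Complex.exp_ofReal_mul_I_re]
    ring
  · rw [← hsq, Complex.neg_re, Complex.log_re, Real.log_pow]
    push_cast
    ring

/-- Agreement of the Fourier-series representation of the Neumann Green's function
of the unit disk with its explicit formula: for `0 ≤ r < R < 1` and any angle `θ`,
`(1/(2π))·[ r²/2 + R²/2 − ln R − 3/4 + Σ_{n=1}^∞ cos(nθ)(rⁿRⁿ + rⁿR^{−n})/n ]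
  = −(1/(4π))·ln(r² + R² − 2rR cos θ)
    + (1/(4π))·[ −ln(r²R² + 1 − 2rR cos θ) + r² + R² − 3/2 ]`. -/
theorem disk_green_fourier_eq_explicit (r R θ : ℝ)
    (hr0 : 0 ≤ r) (hrR : r < R) (hR1 : R < 1) :
    1 / (2 * Real.pi) *
        (r ^ 2 / 2 + R ^ 2 / 2 - Real.log R - 3 / 4 +
          ∑' n : ℕ,
            Real.cos ((n + 1) * θ) *
              (r ^ (n + 1) * R ^ (n + 1) + r ^ (n + 1) * R ^ (-((n : ℤ) + 1))) / (n + 1))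
      = -(1 / (4 * Real.pi)) * Real.log (r ^ 2 + R ^ 2 - 2 * r * R * Real.cos θ) +
        1 / (4 * Real.pi) *
          (-Real.log (r ^ 2 * R ^ 2 + 1 - 2 * r * R * Real.cos θ) +
            r ^ 2 + R ^ 2 - 3 / 2) := by
  have hR : 0 < R := hr0.trans_lt hrR
  have hdiv : r / R < 1 := (div_lt_one hR).2 hrR
  have hsum := (hasSum_cos_mul_pow_div (mul_nonneg hr0 hR.le)
    (mul_lt_one_of_nonneg_of_lt_one_left hr0 (hrR.trans hR1) hR1.le) θ).add
    (hasSum_cos_mul_pow_div (div_nonneg hr0 hR.le) hdiv θ)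
  have hterm : ∀ n : ℕ, Real.cos ((n + 1) * θ) *
      (r ^ (n + 1) * R ^ (n + 1) + r ^ (n + 1) * R ^ (-((n : ℤ) + 1))) / (n + 1) =
      Real.cos ((n + 1) * θ) * (r * R) ^ (n + 1) / (n + 1) +
        Real.cos ((n + 1) * θ) * (r / R) ^ (n + 1) / (n + 1) := by
    intro n
    have hzpow : R ^ (-((n : ℤ) + 1)) = (R ^ (n + 1))⁻¹ := by
      rw [zpow_neg]
      norm_cast
    rw [hzpow, mul_pow, div_pow]
    ring
  have hpos : 0 < 1 + (r / R) ^ 2 - 2 * (r / R) * Real.cos θ := by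
    nlinarith [mul_nonneg (div_nonneg hr0 hR.le) (sub_nonneg.2 (Real.cos_le_one θ)),
      pow_pos (sub_pos.2 hdiv) 2]
  have hlog : Real.log (r ^ 2 + R ^ 2 - 2 * r * R * Real.cos θ) =
      2 * Real.log R + Real.log (1 + (r / R) ^ 2 - 2 * (r / R) * Real.cos θ) := by
    have hfactor : r ^ 2 + R ^ 2 - 2 * r * R * Real.cos θ =
        R ^ 2 * (1 + (r / R) ^ 2 - 2 * (r / R) * Real.cos θ) := by
      field_simp
      ring
    rw [hfactor, Real.log_mul (pow_pos hR 2).ne' hpos.ne', Real.log_pow]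
    push_cast
    ring
  have harg : r ^ 2 * R ^ 2 + 1 - 2 * r * R * Real.cos θ =
      1 + (r * R) ^ 2 - 2 * (r * R) * Real.cos θ := by ring
  rw [tsum_congr hterm, hsum.tsum_eq, hlog, harg]
  field_simp
  ring
end
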